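/- arXiv:2003.00081 — 2 statements merged into one kernel-verified Lean document; each statement's English description precedes it below -/
import Mathlib

section
/- For the ReLU activation φ(u) = max(u, 0), and (Z, Ẑ) a mean-zero bivariate Gaussian with Var(Z) = Var(Ẑ) = K and Cov(Z, Ẑ) = K ρ with ρ ∈ [−1, 1], one has E[φ(Z) φ(Ẑ)] = (K / (2π)) (√(1 − ρ²) + ρ (π − arccos ρ)). -/
open MeasureTheory ProbabilityTheory Matrix

/-- `Z` is a Gaussian random vector with mean `m` and covariance `S`:
every linear functional `c ⬝ᵥ Z` is real Gaussian with mean `c ⬝ᵥ m` and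
variance `c ⬝ᵥ S c`. -/
def IsGaussianVector {Ω : Type*} [MeasurableSpace Ω] (P : Measure Ω) {n : ℕ}
    (Z : Ω → Fin n → ℝ) (m : Fin n → ℝ) (S : Matrix (Fin n) (Fin n) ℝ) : Prop :=
  ∀ c : Fin n → ℝ,
    Measure.map (fun ω => c ⬝ᵥ Z ω) P
      = gaussianReal (c ⬝ᵥ m) (Real.toNNReal (c ⬝ᵥ S.mulVec c))

/-- Angular integral. -/
lemma relu_angle_integral (a : ℝ) (h0 : 0 ≤ a) (h1 : a ≤ Real.pi) :
    ∫ t in Set.Ioo (-Real.pi) Real.pi, max (Real.cos t) 0 * max (Real.cos (t - a)) 0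
      = (Real.sin a + Real.cos a * (Real.pi - a)) / 2 := by
  have hpi := Real.pi_pos
  rw [← integral_Ioc_eq_integral_Ioo]
  have hsub : Set.Ioc (a - Real.pi / 2) (Real.pi / 2) ⊆ Set.Ioc (-Real.pi) Real.pi := by
    intro t ht
    exact ⟨by linarith [ht.1], by linarith [ht.2]⟩
  rw [setIntegral_eq_of_subset_of_forall_sdiff_eq_zero measurableSet_Ioc hsub]
  · have h2 : ∫ t in Set.Ioc (a - Real.pi / 2) (Real.pi / 2),
        max (Real.cos t) 0 * max (Real.cos (t - a)) 0
        = ∫ t in Set.Ioc (a - Real.pi / 2) (Real.pi / 2),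
          (Real.cos (2 * t - a) * 2 / 4 + Real.cos a / 2) := by
      refine setIntegral_congr_fun measurableSet_Ioc fun t ht => ?_
      have e1 : 0 ≤ Real.cos t :=
        Real.cos_nonneg_of_mem_Icc ⟨by linarith [ht.1], ht.2⟩
      have e2 : 0 ≤ Real.cos (t - a) :=
        Real.cos_nonneg_of_mem_Icc ⟨by linarith [ht.1], by linarith [ht.2]⟩
      simp only [max_eq_left e1, max_eq_left e2]
      have e3 : Real.cos (2 * t - a) = Real.cos (t + (t - a)) := by ring_nf
      have e4 : Real.cos a = Real.cos (t - (t - a)) := by ring_nf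
      rw [e3, e4, Real.cos_add, Real.cos_sub t (t - a)]
      ring
    rw [h2, ← intervalIntegral.integral_of_le (by linarith)]
    have hd : ∀ t ∈ Set.uIcc (a - Real.pi / 2) (Real.pi / 2),
        HasDerivAt (fun t => Real.sin (2 * t - a) / 4 + t * (Real.cos a / 2))
          (Real.cos (2 * t - a) * 2 / 4 + Real.cos a / 2) t := by
      intro t _
      have i1 : HasDerivAt (fun t : ℝ => 2 * t - a) 2 t := by
        simpa using ((hasDerivAt_id t).const_mul 2).sub_const a
      have i2 := (i1.sin).div_const 4
      have i3 : HasDerivAt (fun t : ℝ => t * (Real.cos a / 2)) (Real.cos a / 2) t := by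
        simpa using (hasDerivAt_id t).mul_const (Real.cos a / 2)
      exact i2.add i3
    rw [intervalIntegral.integral_eq_sub_of_hasDerivAt hd
      (Continuous.intervalIntegrable (by fun_prop) _ _)]
    have j1 : Real.sin (2 * (Real.pi / 2) - a) = Real.sin a := by
      rw [← Real.sin_pi_sub a]; ring_nf
    have j2 : Real.sin (2 * (a - Real.pi / 2) - a) = - Real.sin a := by
      rw [← Real.sin_sub_pi a]; ring_nf
    rw [j1, j2]
    ring
  · rintro t ⟨⟨ht1, ht2⟩, ht3⟩
    have key : Real.cos t ≤ 0 ∨ Real.cos (t - a) ≤ 0 := by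
      rcases lt_or_ge (Real.pi / 2) t with h | h
      · left
        exact Real.cos_nonpos_of_pi_div_two_le_of_le h.le (by linarith)
      · have h4 : t ≤ a - Real.pi / 2 := by
          by_contra hc
          exact ht3 ⟨not_le.mp hc, h⟩
        rcases lt_or_ge t (-(Real.pi / 2)) with h5 | h5
        · left
          rw [← Real.cos_neg]
          exact Real.cos_nonpos_of_pi_div_two_le_of_le (by linarith) (by linarith)
        · right
          rw [← Real.cos_neg]
          exact Real.cos_nonpos_of_pi_div_two_le_of_le (by linarith) (by linarith)
    rcases key with h | h
    · rw [max_eq_right h, zero_mul]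
    · rw [max_eq_right h, mul_zero]

/-- Radial integral. -/
lemma relu_radial_integral :
    ∫ r in Set.Ioi (0 : ℝ), r ^ 3 * Real.exp (-r ^ 2 / 2) = 2 := by
  have h := integral_rpow_mul_exp_neg_mul_rpow (p := 2) (q := 3) (b := 1 / 2)
    (by norm_num) (by norm_num) (by norm_num)
  have e : ∫ r in Set.Ioi (0 : ℝ), r ^ 3 * Real.exp (-r ^ 2 / 2)
      = ∫ x in Set.Ioi (0 : ℝ), x ^ (3 : ℝ) * Real.exp (-(1 / 2) * x ^ (2 : ℝ)) := by
    refine setIntegral_congr_fun measurableSet_Ioi fun r _ => ?_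
    rw [show (3 : ℝ) = ((3 : ℕ) : ℝ) by norm_num, Real.rpow_natCast,
      show (2 : ℝ) = ((2 : ℕ) : ℝ) by norm_num, Real.rpow_natCast]
    congr 2
    push_cast
    ring
  rw [e, h]
  rw [show ((3 : ℝ) + 1) / 2 = 2 by norm_num, Real.Gamma_two,
    show -((3 : ℝ) + 1) / 2 = ((-2 : ℤ) : ℝ) by norm_num, Real.rpow_intCast]
  norm_num

/-- The kernel for independent standard Gaussians. -/
lemma relu_std_integral (a : ℝ) (h0 : 0 ≤ a) (h1 : a ≤ Real.pi) :
    ∫ p : ℝ × ℝ, max p.1 0 * max (Real.cos a * p.1 + Real.sin a * p.2) 0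
        ∂((gaussianReal 0 1).prod (gaussianReal 0 1))
      = 1 / (2 * Real.pi) * (Real.sin a + Real.cos a * (Real.pi - a)) := by
  have hpi := Real.pi_pos
  rw [gaussianReal_of_var_ne_zero 0 one_ne_zero,
    prod_withDensity (measurable_gaussianPDF _ _) (measurable_gaussianPDF _ _),
    integral_withDensity_eq_integral_toReal_smul (by fun_prop)
      (ae_of_all _ fun _ => ENNReal.mul_lt_top gaussianPDF_lt_top gaussianPDF_lt_top),
    ← Measure.volume_eq_prod, ← integral_comp_polarCoord_symm, polarCoord_target]
  have e : ∀ p ∈ Set.Ioi (0 : ℝ) ×ˢ Set.Ioo (-Real.pi) Real.pi,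
      p.1 • ((fun q : ℝ × ℝ => (gaussianPDF 0 1 q.1 * gaussianPDF 0 1 q.2).toReal •
        (max q.1 0 * max (Real.cos a * q.1 + Real.sin a * q.2) 0)) (polarCoord.symm p))
      = ((2 * Real.pi)⁻¹ * (p.1 ^ 3 * Real.exp (-p.1 ^ 2 / 2))) *
        (max (Real.cos p.2) 0 * max (Real.cos (p.2 - a)) 0) := by
    rintro ⟨r, t⟩ ⟨hr, -⟩
    have hr' : 0 ≤ r := le_of_lt hr
    simp only [polarCoord_symm_apply, ENNReal.toReal_mul, toReal_gaussianPDF, smul_eq_mul,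
      gaussianPDFReal_def]
    have f1 : max (r * Real.cos t) 0 = r * max (Real.cos t) 0 := by
      rw [mul_max_of_nonneg _ _ hr', mul_zero]
    have f2 : max (Real.cos a * (r * Real.cos t) + Real.sin a * (r * Real.sin t)) 0
        = r * max (Real.cos (t - a)) 0 := by
      rw [mul_max_of_nonneg _ _ hr', mul_zero, Real.cos_sub]
      ring_nf
    have f3 : Real.exp (-r ^ 2 / 2) = Real.exp (-(r * Real.cos t - 0) ^ 2 / (2 * ((1 : NNReal) : ℝ)))
        * Real.exp (-(r * Real.sin t - 0) ^ 2 / (2 * ((1 : NNReal) : ℝ))) := by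
      rw [← Real.exp_add]
      congr 1
      have := Real.sin_sq_add_cos_sq t
      simp only [NNReal.coe_one]
      linear_combination (-(r ^ 2) / 2) * (-this)
    have f4 : (2 * Real.pi)⁻¹ = (√(2 * Real.pi * ((1 : NNReal) : ℝ)))⁻¹ *
        (√(2 * Real.pi * ((1 : NNReal) : ℝ)))⁻¹ := by
      rw [← mul_inv, Real.mul_self_sqrt (by simp; positivity)]
      simp
    rw [f1, f2, f3, f4]
    ring
  rw [setIntegral_congr_fun (measurableSet_Ioi.prod measurableSet_Ioo) e,
    Measure.volume_eq_prod, setIntegral_prod_mul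
      (fun r : ℝ => (2 * Real.pi)⁻¹ * (r ^ 3 * Real.exp (-r ^ 2 / 2)))
      (fun t : ℝ => max (Real.cos t) 0 * max (Real.cos (t - a)) 0),
    integral_const_mul, relu_radial_integral, relu_angle_integral a h0 h1]
  field_simp

/-- Linear combinations of independent standard Gaussians. -/
lemma relu_std_map (c d : ℝ) :
    Measure.map (fun p : ℝ × ℝ => c * p.1 + d * p.2)
      ((gaussianReal 0 1).prod (gaussianReal 0 1))
      = gaussianReal 0 (Real.toNNReal (c ^ 2 + d ^ 2)) := by
  have h := Measure.map_prod_map (gaussianReal 0 1) (gaussianReal 0 1)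
    (f := fun x : ℝ => c * x) (g := fun x : ℝ => d * x) (by fun_prop) (by fun_prop)
  have h2 : (fun p : ℝ × ℝ => c * p.1 + d * p.2)
      = (fun p : ℝ × ℝ => p.1 + p.2) ∘ (Prod.map (fun x : ℝ => c * x) (fun x : ℝ => d * x)) := by
    ext p; simp
  rw [h2, ← Measure.map_map (by fun_prop) (by fun_prop), ← h,
    gaussianReal_map_const_mul, gaussianReal_map_const_mul]
  have h3 := gaussianReal_conv_gaussianReal (m₁ := c * 0) (m₂ := d * 0)
    (v₁ := .mk (c ^ 2) (sq_nonneg _) * 1) (v₂ := .mk (d ^ 2) (sq_nonneg _) * 1)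
  rw [Measure.conv] at h3
  rw [h3]
  congr 1
  · simp
  · ext
    rw [Real.coe_toNNReal _ (by positivity)]
    simp

/-- Arccosine kernel: for ReLU `φ` and `(Z, Ẑ)` mean-zero bivariate Gaussian
with `Var Z = Var Ẑ = K` and `Cov(Z, Ẑ) = K ρ`,
`E[φ(Z) φ(Ẑ)] = (K / 2π)(√(1 − ρ²) + ρ (π − arccos ρ))`. -/
theorem relu_arccos_kernel {Ω : Type*} [MeasurableSpace Ω]
    (P : Measure Ω) [IsProbabilityMeasure P]
    (Z Zhat : Ω → ℝ) (K ρ : ℝ) (hK : 0 ≤ K) (hρ : ρ ∈ Set.Icc (-1 : ℝ) 1)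
    (hG : IsGaussianVector P (fun ω => ![Z ω, Zhat ω]) 0 !![K, K * ρ; K * ρ, K]) :
    ∫ ω, max (Z ω) 0 * max (Zhat ω) 0 ∂P
      = K / (2 * Real.pi) * (Real.sqrt (1 - ρ ^ 2) + ρ * (Real.pi - Real.arccos ρ)) := by
  have hex : ∃ a, 0 ≤ a ∧ a ≤ Real.pi ∧ Real.cos a = ρ ∧ Real.sin a = √(1 - ρ ^ 2) ∧
      Real.arccos ρ = a :=
    ⟨Real.arccos ρ, Real.arccos_nonneg _, Real.arccos_le_pi _, Real.cos_arccos hρ.1 hρ.2,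
      Real.sin_arccos _, rfl⟩
  obtain ⟨a, h0, h1, hc, hs, ha⟩ := hex
  rw [ha, ← hs, ← hc]
  have hlin : ∀ x y : ℝ, Measure.map (fun ω => x * Z ω + y * Zhat ω) P
      = gaussianReal 0 (Real.toNNReal (K * (x ^ 2 + 2 * ρ * x * y + y ^ 2))) := by
    intro x y
    have := hG ![x, y]
    simp only [dotProduct, Fin.sum_univ_two, mulVec] at this
    simp at this
    rw [this]
    congr 2
    ring
  have aem : ∀ x y : ℝ, AEMeasurable (fun ω => x * Z ω + y * Zhat ω) P := by
    intro x y
    by_contra hn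
    have h2 := hlin x y
    rw [Measure.map_of_not_aemeasurable hn] at h2
    exact IsProbabilityMeasure.ne_zero _ h2.symm
  have mZ : AEMeasurable Z P := by simpa using aem 1 0
  have mZ' : AEMeasurable Zhat P := by simpa using aem 0 1
  have mZZ : AEMeasurable (fun ω => (Z ω, Zhat ω)) P := mZ.prodMk mZ'
  let T : ℝ × ℝ → ℝ × ℝ := fun p =>
    (√K * p.1, √K * (Real.cos a * p.1 + Real.sin a * p.2))
  have mT : Measurable T := by fun_prop
  have hsK : √K ^ 2 = K := Real.sq_sqrt hK
  have hcs := Real.sin_sq_add_cos_sq a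
  have law : Measure.map (fun ω => (Z ω, Zhat ω)) P
      = Measure.map T ((gaussianReal 0 1).prod (gaussianReal 0 1)) := by
    have : IsProbabilityMeasure (Measure.map (fun ω => (Z ω, Zhat ω)) P) :=
      Measure.isProbabilityMeasure_map mZZ
    have : IsProbabilityMeasure
        (Measure.map T ((gaussianReal 0 1).prod (gaussianReal 0 1))) :=
      Measure.isProbabilityMeasure_map mT.aemeasurable
    apply Measure.ext_of_charFunDual
    ext L
    have hL : ∀ u v : ℝ, L (u, v) = L (1, 0) * u + L (0, 1) * v := by
      intro u v
      have : ((u, v) : ℝ × ℝ) = u • ((1, 0) : ℝ × ℝ) + v • ((0, 1) : ℝ × ℝ) := by simp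
      rw [this, map_add, map_smul, map_smul]
      simp only [smul_eq_mul]
      ring
    rw [charFunDual_eq_charFun_map_one, charFunDual_eq_charFun_map_one]
    congr 1
    rw [AEMeasurable.map_map_of_aemeasurable L.continuous.aemeasurable mZZ,
      Measure.map_map L.continuous.measurable mT]
    have g1 : (L ∘ fun ω => (Z ω, Zhat ω))
        = fun ω => L (1, 0) * Z ω + L (0, 1) * Zhat ω := by
      ext ω; exact hL _ _
    have g2 : L ∘ T = fun p => (√K * (L (1, 0) + L (0, 1) * Real.cos a)) * p.1
        + (√K * L (0, 1) * Real.sin a) * p.2 := by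
      ext p
      simp only [Function.comp, T]
      rw [hL]
      ring
    rw [g1, g2, hlin, relu_std_map]
    congr 2
    rw [← hc]
    linear_combination (-(L (1, 0) + L (0, 1) * Real.cos a) ^ 2
      - (L (0, 1) * Real.sin a) ^ 2) * hsK - K * L (0, 1) ^ 2 * hcs
  have hm : Continuous (fun p : ℝ × ℝ => max p.1 0 * max p.2 0) := by fun_prop
  have s1 := integral_map mZZ (f := fun p : ℝ × ℝ => max p.1 0 * max p.2 0)
    hm.aestronglyMeasurable
  rw [law, integral_map mT.aemeasurable hm.aestronglyMeasurable] at s1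
  rw [← s1]
  have s2 : ∀ p : ℝ × ℝ, max (T p).1 0 * max (T p).2 0
      = K * (max p.1 0 * max (Real.cos a * p.1 + Real.sin a * p.2) 0) := by
    intro p
    have k : ∀ u : ℝ, max (√K * u) 0 = √K * max u 0 := by
      intro u
      rw [mul_max_of_nonneg _ _ (Real.sqrt_nonneg K), mul_zero]
    simp only [T, k]
    linear_combination (max p.1 0 * max (Real.cos a * p.1 + Real.sin a * p.2) 0) * hsK
  simp only [s2]
  rw [integral_const_mul, relu_std_integral a h0 h1]
  ring
end

section
/- For mean-zero jointly Gaussian (Z, Ẑ) with unit variances and correlation ρ, the map ρ ↦ E[φ(Z)φ(Ẑ)] is nondecreasing on [−1, 1] for any nondecreasing φ: ℝ → ℝ with E[φ(Z)²] < ∞. -/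
open MeasureTheory ProbabilityTheory

/-- Second moment `E[φ(Z) φ(Ẑ)]` of a standard Gaussian pair with correlation
`ρ`, realized as `Z = U`, `Ẑ = ρ U + √(1 − ρ²) V` with `U, V` i.i.d. `N(0,1)`. -/
noncomputable def corrMoment (φ : ℝ → ℝ) (ρ : ℝ) : ℝ :=
  ∫ p : ℝ × ℝ, φ p.1 * φ (ρ * p.1 + Real.sqrt (1 - ρ ^ 2) * p.2)
    ∂((gaussianReal 0 1).prod (gaussianReal 0 1))

/-- Product of `n` standard Gaussians. -/
noncomputable abbrev stdPi (n : ℕ) : Measure (Fin n → ℝ) :=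
  Measure.pi (fun _ : Fin n => gaussianReal 0 1)

lemma stdPi_cexp (n : ℕ) (t : Fin n → ℝ) :
    ∫ u, Complex.exp (((∑ i, t i * u i : ℝ) : ℂ) * Complex.I) ∂(stdPi n)
      = Complex.exp ((-(∑ i, t i ^ 2) / 2 : ℝ) : ℂ) := by
  have h1 : ∀ u : Fin n → ℝ, Complex.exp (((∑ i, t i * u i : ℝ) : ℂ) * Complex.I)
      = ∏ i, Complex.exp ((t i : ℂ) * (u i : ℂ) * Complex.I) := by
    intro u
    rw [← Complex.exp_sum, ← Finset.sum_mul]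
    push_cast
    rfl
  simp_rw [h1]
  rw [integral_fintype_prod_eq_prod
    (f := fun (i : Fin n) (x : ℝ) => Complex.exp ((t i : ℂ) * (x : ℂ) * Complex.I))]
  simp_rw [← charFun_apply_real, charFun_gaussianReal]
  rw [← Complex.exp_sum]
  congr 1
  push_cast
  simp [neg_div, Finset.sum_div]

lemma stdPi_map_one (n : ℕ) (a : Fin n → ℝ) (ha : ∑ i, a i ^ 2 = 1) :
    (stdPi n).map (fun u => ∑ i, a i * u i) = gaussianReal 0 1 := by
  have hm : Measurable (fun u : Fin n → ℝ => ∑ i, a i * u i) := by fun_prop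
  have := Measure.isProbabilityMeasure_map (μ := stdPi n) hm.aemeasurable
  apply Measure.ext_of_charFun
  ext t
  rw [charFun_apply_real, integral_map hm.aemeasurable (by fun_prop), charFun_gaussianReal]
  have := stdPi_cexp n (fun i => t * a i)
  simp_rw [mul_assoc, ← Finset.mul_sum, mul_pow, ← Finset.mul_sum, ha] at this
  push_cast at this ⊢
  simp only [mul_assoc] at this ⊢
  rw [this]
  congr 1
  simp [neg_div]

lemma stdPi_map_two (n m : ℕ) (a b : Fin n → ℝ) (c d : Fin m → ℝ)
    (h1 : ∑ i, a i ^ 2 = ∑ i, c i ^ 2) (h2 : ∑ i, b i ^ 2 = ∑ i, d i ^ 2)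
    (h3 : ∑ i, a i * b i = ∑ i, c i * d i) :
    (stdPi n).map (fun u => (∑ i, a i * u i, ∑ i, b i * u i))
      = (stdPi m).map (fun u => (∑ i, c i * u i, ∑ i, d i * u i)) := by
  have key : ∀ (n : ℕ) (a b : Fin n → ℝ) (L : StrongDual ℝ (ℝ × ℝ)),
      charFunDual ((stdPi n).map (fun u => (∑ i, a i * u i, ∑ i, b i * u i))) L
      = Complex.exp ((-(L (1, 0) ^ 2 * ∑ i, a i ^ 2 + 2 * L (1, 0) * L (0, 1) * ∑ i, a i * b i
          + L (0, 1) ^ 2 * ∑ i, b i ^ 2) / 2 : ℝ) : ℂ) := by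
    intro n a b L
    have hm : Measurable (fun u : Fin n → ℝ => (∑ i, a i * u i, ∑ i, b i * u i)) := by fun_prop
    have hL : ∀ x y : ℝ, L (x, y) = L (1, 0) * x + L (0, 1) * y := by
      intro x y
      have : (x, y) = x • ((1 : ℝ), (0 : ℝ)) + y • ((0 : ℝ), (1 : ℝ)) := by simp
      rw [this, map_add, map_smul, map_smul, smul_eq_mul, smul_eq_mul]
      ring
    rw [charFunDual_apply, integral_map hm.aemeasurable (by fun_prop)]
    have h := stdPi_cexp n (fun i => L (1, 0) * a i + L (0, 1) * b i)
    have e1 : ∀ u : Fin n → ℝ, ∑ i, (L (1, 0) * a i + L (0, 1) * b i) * u i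
        = L (∑ i, a i * u i, ∑ i, b i * u i) := by
      intro u
      rw [hL (∑ i, a i * u i) (∑ i, b i * u i), Finset.mul_sum, Finset.mul_sum, ← Finset.sum_add_distrib]
      exact Finset.sum_congr rfl fun i _ => by ring
    have e2 : ∑ i, (L (1, 0) * a i + L (0, 1) * b i) ^ 2
        = L (1, 0) ^ 2 * ∑ i, a i ^ 2 + 2 * L (1, 0) * L (0, 1) * ∑ i, a i * b i
          + L (0, 1) ^ 2 * ∑ i, b i ^ 2 := by
      rw [Finset.mul_sum, Finset.mul_sum, Finset.mul_sum, ← Finset.sum_add_distrib,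
        ← Finset.sum_add_distrib]
      exact Finset.sum_congr rfl fun i _ => by ring
    simp_rw [e1, e2] at h
    exact h
  have := Measure.isProbabilityMeasure_map (μ := stdPi n)
    (f := fun u => (∑ i, a i * u i, ∑ i, b i * u i)) (by fun_prop)
  have := Measure.isProbabilityMeasure_map (μ := stdPi m)
    (f := fun u => (∑ i, c i * u i, ∑ i, d i * u i)) (by fun_prop)
  apply Measure.ext_of_charFunDual
  ext L
  rw [key, key, h1, h2, h3]

lemma stdPi_integral (φ : ℝ → ℝ) (hmeas : Measurable φ) (n : ℕ) (a b : Fin n → ℝ) (ρ : ℝ)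
    (hρ : ρ ^ 2 ≤ 1) (ha : ∑ i, a i ^ 2 = 1) (hb : ∑ i, b i ^ 2 = 1)
    (hab : ∑ i, a i * b i = ρ) :
    ∫ u, φ (∑ i, a i * u i) * φ (∑ i, b i * u i) ∂(stdPi n) = corrMoment φ ρ := by
  have hs : Real.sqrt (1 - ρ ^ 2) ^ 2 = 1 - ρ ^ 2 := Real.sq_sqrt (by linarith)
  have hmap := stdPi_map_two n 2 a b ![1, 0] ![ρ, Real.sqrt (1 - ρ ^ 2)]
    (by simp [ha]) (by simp [hb, hs]) (by simp [hab])
  have hF : Measurable (fun p : ℝ × ℝ => φ p.1 * φ p.2) := by fun_prop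
  have e1 := integral_map (μ := stdPi n) (φ := fun u => (∑ i, a i * u i, ∑ i, b i * u i))
    (by fun_prop) (f := fun p : ℝ × ℝ => φ p.1 * φ p.2) hF.aestronglyMeasurable
  have e2 := integral_map (μ := stdPi 2)
    (φ := fun u => (∑ i, (![1, 0] : Fin 2 → ℝ) i * u i,
      ∑ i, (![ρ, Real.sqrt (1 - ρ ^ 2)] : Fin 2 → ℝ) i * u i))
    (by fun_prop) (f := fun p : ℝ × ℝ => φ p.1 * φ p.2) hF.aestronglyMeasurable
  rw [← e1, hmap, e2]
  unfold corrMoment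
  rw [← (measurePreserving_finTwoArrow (gaussianReal 0 1)).integral_comp
    (MeasurableEquiv.finTwoArrow).measurableEmbedding]
  simp [MeasurableEquiv.finTwoArrow]

lemma stdPi_integrable (φ : ℝ → ℝ) (hmeas : Measurable φ)
    (hL2 : Integrable (fun u => φ u ^ 2) (gaussianReal 0 1)) (n : ℕ) (a b : Fin n → ℝ)
    (ha : ∑ i, a i ^ 2 = 1) (hb : ∑ i, b i ^ 2 = 1) :
    Integrable (fun u => φ (∑ i, a i * u i) * φ (∑ i, b i * u i)) (stdPi n) := by
  have hφ : MemLp φ 2 (gaussianReal 0 1) :=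
    (memLp_two_iff_integrable_sq hmeas.aestronglyMeasurable).2 hL2
  have key : ∀ a : Fin n → ℝ, ∑ i, a i ^ 2 = 1 →
      MemLp (fun u => φ (∑ i, a i * u i)) 2 (stdPi n) := fun a ha =>
    hφ.comp_measurePreserving ⟨by fun_prop, stdPi_map_one n a ha⟩
  exact (key a ha).integrable_mul (key b hb)

/-- Comparison lemma: correlation `ρ = ε s²` versus `c ρ`. -/
lemma corr_compare (φ : ℝ → ℝ) (hmeas : Measurable φ) (hmono : Monotone φ)
    (hL2 : Integrable (fun u => φ u ^ 2) (gaussianReal 0 1))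
    (s ε c : ℝ) (hs0 : 0 ≤ s) (hs : s ^ 2 ≤ 1) (hc : c ^ 2 ≤ 1) (hε : ε ^ 2 = 1) :
    0 ≤ ε * (corrMoment φ (ε * s ^ 2) - corrMoment φ (c * (ε * s ^ 2))) := by
  obtain ⟨σ, hσ⟩ : ∃ σ : ℝ, σ ^ 2 = 1 - s ^ 2 := ⟨_, Real.sq_sqrt (by linarith)⟩
  obtain ⟨k, hk⟩ : ∃ k : ℝ, k ^ 2 = 1 - c ^ 2 := ⟨_, Real.sq_sqrt (by linarith)⟩
  have hs4 : (s ^ 2) ^ 2 ≤ 1 := pow_le_one₀ (by positivity) hs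
  have hr1 : (ε * s ^ 2) ^ 2 ≤ 1 := by rw [mul_pow, hε, one_mul]; exact hs4
  have hr2 : (c * (ε * s ^ 2)) ^ 2 ≤ 1 := by
    rw [mul_pow]; exact mul_le_one₀ hc (by positivity) hr1
  set a : Fin 4 → ℝ := ![s, 0, σ, 0] with hadef
  set aAlt : Fin 4 → ℝ := ![s * c, s * k, σ, 0] with hadefAlt
  set b : Fin 4 → ℝ := ![ε * s, 0, 0, σ] with hbdef
  set bAlt : Fin 4 → ℝ := ![ε * (s * c), ε * (s * k), 0, σ] with hbdefAlt
  have ha : ∑ i, a i ^ 2 = 1 := by simp [hadef, Fin.sum_univ_four]; linarith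
  have haAlt : ∑ i, aAlt i ^ 2 = 1 := by
    simp [hadefAlt, Fin.sum_univ_four]; rw [mul_pow, mul_pow, hk, hσ]; ring
  have hb : ∑ i, b i ^ 2 = 1 := by
    simp [hbdef, Fin.sum_univ_four]; rw [mul_pow, hε, hσ]; ring
  have hbAlt : ∑ i, bAlt i ^ 2 = 1 := by
    simp [hbdefAlt, Fin.sum_univ_four]; simp only [mul_pow, hε, hk, hσ]; ring
  have hab : ∑ i, a i * b i = ε * s ^ 2 := by
    simp [hadef, hbdef, Fin.sum_univ_four]; ring
  have habAlt : ∑ i, aAlt i * bAlt i = ε * s ^ 2 := by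
    simp [hadefAlt, hbdefAlt, Fin.sum_univ_four]; linear_combination ε * s ^ 2 * hk
  have hx : ∑ i, a i * bAlt i = c * (ε * s ^ 2) := by
    simp [hadef, hbdefAlt, Fin.sum_univ_four]; ring
  have hxAlt : ∑ i, aAlt i * b i = c * (ε * s ^ 2) := by
    simp [hadefAlt, hbdef, Fin.sum_univ_four]; ring
  have I1 := stdPi_integral φ hmeas 4 a b _ hr1 ha hb hab
  have I2 := stdPi_integral φ hmeas 4 aAlt bAlt _ hr1 haAlt hbAlt habAlt
  have I3 := stdPi_integral φ hmeas 4 a bAlt _ hr2 ha hbAlt hx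
  have I4 := stdPi_integral φ hmeas 4 aAlt b _ hr2 haAlt hb hxAlt
  have J1 := stdPi_integrable φ hmeas hL2 4 a b ha hb
  have J2 := stdPi_integrable φ hmeas hL2 4 aAlt bAlt haAlt hbAlt
  have J3 := stdPi_integrable φ hmeas hL2 4 a bAlt ha hbAlt
  have J4 := stdPi_integrable φ hmeas hL2 4 aAlt b haAlt hb
  have hint : ∫ u, ε * ((φ (∑ i, a i * u i) * φ (∑ i, b i * u i)
      + φ (∑ i, aAlt i * u i) * φ (∑ i, bAlt i * u i))
      - (φ (∑ i, a i * u i) * φ (∑ i, bAlt i * u i)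
      + φ (∑ i, aAlt i * u i) * φ (∑ i, b i * u i))) ∂(stdPi 4)
      = ε * ((corrMoment φ (ε * s ^ 2) + corrMoment φ (ε * s ^ 2))
        - (corrMoment φ (c * (ε * s ^ 2)) + corrMoment φ (c * (ε * s ^ 2)))) := by
    rw [integral_const_mul, integral_sub (by exact J1.add J2) (by exact J3.add J4), integral_add J1 J2,
      integral_add J3 J4, I1, I2, I3, I4]
  have hpos : 0 ≤ ∫ u, ε * ((φ (∑ i, a i * u i) * φ (∑ i, b i * u i)
      + φ (∑ i, aAlt i * u i) * φ (∑ i, bAlt i * u i))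
      - (φ (∑ i, a i * u i) * φ (∑ i, bAlt i * u i)
      + φ (∑ i, aAlt i * u i) * φ (∑ i, b i * u i))) ∂(stdPi 4) := by
    apply integral_nonneg
    intro u
    have hfac : ∀ p q r t : ℝ, ε * ((p * q + r * t) - (p * t + r * q))
        = (p - r) * (ε * (q - t)) := fun p q r t => by ring
    show 0 ≤ ε * _
    rw [hfac]
    have eb : ∑ i, b i * u i - ∑ i, bAlt i * u i
        = ε * (∑ i, a i * u i - ∑ i, aAlt i * u i) := by
      simp [hadef, hadefAlt, hbdef, hbdefAlt, Fin.sum_univ_four]; ring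
    have hεAlt : ε = 1 ∨ ε = -1 := by simpa using hε
    rcases le_total (∑ i, a i * u i) (∑ i, aAlt i * u i) with h | h
    · have h1 := hmono h
      rcases hεAlt with rfl | rfl
      · have h2 := hmono (show ∑ i, b i * u i ≤ ∑ i, bAlt i * u i by linarith)
        nlinarith
      · have h2 := hmono (show ∑ i, bAlt i * u i ≤ ∑ i, b i * u i by linarith)
        nlinarith
    · have h1 := hmono h
      rcases hεAlt with rfl | rfl
      · have h2 := hmono (show ∑ i, bAlt i * u i ≤ ∑ i, b i * u i by linarith)
        nlinarith
      · have h2 := hmono (show ∑ i, b i * u i ≤ ∑ i, bAlt i * u i by linarith)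
        nlinarith
  rw [hint] at hpos
  linarith

/-- For a mean-zero jointly Gaussian pair with unit variances and correlation
`ρ`, the map `ρ ↦ E[φ(Z) φ(Ẑ)]` is nondecreasing on `[−1, 1]` for any
nondecreasing `φ` with `E[φ(Z)²] < ∞`. -/
theorem corrMoment_monotone (φ : ℝ → ℝ) (hmeas : Measurable φ) (hmono : Monotone φ)
    (hL2 : Integrable (fun u => φ u ^ 2) (gaussianReal 0 1)) :
    MonotoneOn (corrMoment φ) (Set.Icc (-1 : ℝ) 1) := by
  intro x hx y hy hxy
  have ratio : ∀ p q : ℝ, |p| ≤ |q| → ∃ c : ℝ, c ^ 2 ≤ 1 ∧ c * q = p := by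
    intro p q h
    by_cases hq : q = 0
    · subst hq
      have : p = 0 := by simpa using h
      exact ⟨0, by norm_num, by simp [this]⟩
    · refine ⟨p / q, ?_, div_mul_cancel₀ p hq⟩
      rw [div_pow, div_le_one (by positivity)]
      exact sq_le_sq.2 h
  rcases le_total (-x) y with h | h
  · have hy0 : 0 ≤ y := by linarith
    obtain ⟨c, hc, hcx⟩ := ratio x y (by rw [abs_of_nonneg hy0]; exact abs_le.2 ⟨by linarith, hxy⟩)
    have := corr_compare φ hmeas hmono hL2 (Real.sqrt y) 1 c (Real.sqrt_nonneg _)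
      (by rw [Real.sq_sqrt hy0]; exact hy.2) hc (by norm_num)
    rw [Real.sq_sqrt hy0, one_mul, one_mul, hcx] at this
    linarith
  · have hx0 : 0 ≤ -x := by linarith
    obtain ⟨c, hc, hcx⟩ := ratio y x (by
      rw [abs_of_nonpos (by linarith : x ≤ 0)]; exact abs_le.2 ⟨by linarith, h⟩)
    have := corr_compare φ hmeas hmono hL2 (Real.sqrt (-x)) (-1) c (Real.sqrt_nonneg _)
      (by rw [Real.sq_sqrt hx0]; linarith [hx.1]) hc (by norm_num)
    rw [Real.sq_sqrt hx0, neg_one_mul (-x), neg_neg, hcx] at this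
    linarith
end
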